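/- arXiv:math/0605169 — 2 statements merged into one kernel-verified Lean document; each statement's English description precedes it below -/
import Mathlib

section
/- For every integer r and every natural number n, the (n+1)×(n+1) Hankel determinant det(s(i+j;r))_{0≤i,j≤n} of the aerated central binomial sequence s, defined by s(2m;r) = C(2m,m)·r^m and s(2m+1;r) = 0, equals 2^n · r^(n(n+1)/2). (Equivalently: the sequence with exponential generating function I₀(2√r x) has Hankel transform 2^n·r^(n(n+1)/2).) -/
/-- The aerated central binomial sequence: `s(2m) = C(2m,m)·r^m`, `s(2m+1) = 0`.
This is the coefficient sequence (times `n!`) of `I₀(2√r x)`. -/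
def s (r : ℤ) (n : ℕ) : ℤ :=
  if Even n then (n.choose (n / 2) : ℤ) * r ^ (n / 2) else 0

/-- The coefficient of `x ^ k` in `(x + r / x) ^ n`, given by its recurrence in `n`; the symmetry
`x ↦ r / x` accounts for the row `k = 0`. -/
def laurentCoeff (r : ℤ) : ℕ → ℕ → ℤ
  | 0, 0 => 1
  | 0, _ + 1 => 0
  | n + 1, 0 => 2 * r * laurentCoeff r n 1
  | n + 1, k + 1 => laurentCoeff r n k + r * laurentCoeff r n (k + 2)

/-- The diagonal entries in the factorization of the Hankel matrix of `s r`. -/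
def hankelPivot (r : ℤ) (k : ℕ) : ℤ :=
  if k = 0 then 1 else 2 * r ^ k

theorem laurentCoeff_eq_zero_of_lt (r : ℤ) {n k : ℕ} (h : n < k) : laurentCoeff r n k = 0 := by
  induction n generalizing k with
  | zero => obtain _ | k := k <;> simp_all [laurentCoeff]
  | succ n ih =>
    obtain _ | k := k
    · omega
    · rw [laurentCoeff, ih (by omega), ih (by omega)]; simp

theorem laurentCoeff_self (r : ℤ) (n : ℕ) : laurentCoeff r n n = 1 := by
  induction n with
  | zero => rfl
  | succ n ih => rw [laurentCoeff, ih, laurentCoeff_eq_zero_of_lt r (by omega)]; simp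

theorem laurentCoeff_of_eq_add (r : ℤ) {n k m : ℕ} (h : n = k + 2 * m) :
    laurentCoeff r n k = n.choose m * r ^ m := by
  induction n generalizing k m with
  | zero =>
    obtain rfl : k = 0 := by omega
    obtain rfl : m = 0 := by omega
    simp [laurentCoeff]
  | succ n ih =>
    obtain _ | m := m
    · obtain rfl : k = n + 1 := by omega
      simp [laurentCoeff_self]
    obtain _ | k := k
    · have hsymm : n.choose (m + 1) = n.choose m := Nat.choose_symm_of_eq_add (by omega)
      rw [laurentCoeff, ih (m := m) (by omega), Nat.choose_succ_succ, hsymm]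
      push_cast
      ring
    · rw [laurentCoeff, ih (m := m + 1) (by omega), ih (m := m) (by omega), Nat.choose_succ_succ]
      push_cast
      ring

theorem laurentCoeff_of_odd (r : ℤ) {n k : ℕ} (h : Odd (n + k)) : laurentCoeff r n k = 0 := by
  induction n generalizing k with
  | zero => obtain _ | k := k <;> simp_all [laurentCoeff]
  | succ n ih =>
    obtain _ | k := k
    · rw [laurentCoeff, ih (by simpa using h), mul_zero]
    · rw [laurentCoeff, ih (by grind), ih (by grind)]; simp

theorem laurentCoeff_zero_right (r : ℤ) (n : ℕ) : laurentCoeff r n 0 = s r n := by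
  unfold s
  split_ifs with h
  · exact laurentCoeff_of_eq_add r (by grind)
  · exact laurentCoeff_of_odd r (by simpa using h)

/-- A discrete Green identity for the recurrence defining `laurentCoeff`. -/
theorem sum_hankelPivot_mul_sub (r : ℤ) (i j N : ℕ) :
    ∑ k ∈ Finset.range (N + 1), hankelPivot r k *
        (laurentCoeff r (i + 1) k * laurentCoeff r j k
          - laurentCoeff r i k * laurentCoeff r (j + 1) k)
      = 2 * r ^ (N + 1) * (laurentCoeff r i (N + 1) * laurentCoeff r j N
          - laurentCoeff r i N * laurentCoeff r j (N + 1)) := by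
  induction N with
  | zero => simp [hankelPivot, laurentCoeff]; ring
  | succ N ih =>
    rw [Finset.sum_range_succ, ih]
    simp only [hankelPivot, laurentCoeff, Nat.add_eq_zero_iff, one_ne_zero, and_false, if_false]
    ring

theorem sum_hankelPivot_mul_laurentCoeff (r : ℤ) {i N : ℕ} (j : ℕ) (h : i ≤ N) :
    ∑ k ∈ Finset.range (N + 1), laurentCoeff r i k * hankelPivot r k * laurentCoeff r j k
      = s r (i + j) := by
  induction i generalizing j with
  | zero =>
    simp [Finset.sum_range_succ', laurentCoeff, hankelPivot, laurentCoeff_zero_right]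
  | succ i ih =>
    have key := sum_hankelPivot_mul_sub r i j N
    rw [laurentCoeff_eq_zero_of_lt r (show i < N + 1 by omega),
      laurentCoeff_eq_zero_of_lt r (show i < N by omega)] at key
    rw [show i + 1 + j = i + (j + 1) by ring, ← ih (j + 1) (by omega), ← sub_eq_zero,
      ← Finset.sum_sub_distrib]
    simp only [zero_mul, sub_zero, mul_zero] at key
    rw [← key]
    exact Finset.sum_congr rfl fun k _ => by ring

theorem prod_hankelPivot (r : ℤ) (n : ℕ) :
    ∏ k ∈ Finset.range (n + 1), hankelPivot r k = 2 ^ n * r ^ (n * (n + 1) / 2) := by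
  induction n with
  | zero => simp [hankelPivot]
  | succ n ih =>
    have hexp : (n + 1) * (n + 1 + 1) / 2 = n * (n + 1) / 2 + (n + 1) := by
      rw [show (n + 1) * (n + 1 + 1) = n * (n + 1) + (n + 1) * 2 by ring,
        Nat.add_mul_div_right _ _ two_pos]
    rw [Finset.prod_range_succ, ih, hexp, hankelPivot, if_neg (Nat.succ_ne_zero n)]
    ring

/-- The sequence with e.g.f. `I₀(2√r x)` has Hankel transform `2^n · r^(C(n+1,2))`. -/
theorem hankel_aerated_central_binomial (r : ℤ) (n : ℕ) :
    Matrix.det (Matrix.of fun i j : Fin (n + 1) => s r ((i : ℕ) + (j : ℕ)))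
      = 2 ^ n * r ^ (n * (n + 1) / 2) := by
  let L : Matrix (Fin (n + 1)) (Fin (n + 1)) ℤ := Matrix.of fun i k => laurentCoeff r i k
  let D : Matrix (Fin (n + 1)) (Fin (n + 1)) ℤ := Matrix.diagonal fun k => hankelPivot r k
  have hfactor : (Matrix.of fun i j : Fin (n + 1) => s r ((i : ℕ) + (j : ℕ)))
      = L * D * L.transpose := by
    ext i j
    rw [Matrix.mul_apply]
    simp only [L, D, Matrix.mul_diagonal, Matrix.transpose_apply,
      Matrix.of_apply]
    rw [Fin.sum_univ_eq_sum_range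
      (fun k => laurentCoeff r i k * hankelPivot r k * laurentCoeff r j k) (n + 1),
      sum_hankelPivot_mul_laurentCoeff r j (by omega)]
  have hL : L.det = 1 := by
    rw [Matrix.det_of_isLowerTriangular L fun i k hik => laurentCoeff_eq_zero_of_lt r hik]
    simp [L, laurentCoeff_self]
  rw [hfactor, Matrix.det_mul, Matrix.det_mul, Matrix.det_transpose, hL, Matrix.det_diagonal,
    Fin.prod_univ_eq_prod_range (hankelPivot r), prod_hankelPivot, one_mul, mul_one]
end

section
/- For every natural number n, the (n+1)×(n+1) Hankel determinant det(C(i+j) + C(i+j+1))_{0≤i,j≤n} of the sum of consecutive Catalan numbers equals the Fibonacci number F(2n+3). -/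
/-- The Catalan triangle: the number of Dyck prefixes with `2 * n` steps ending at height `2 * k`. -/
def catalanTriangle (n k : ℕ) : ℤ :=
  ((2 * n).choose (n + k) : ℤ) - ((2 * n).choose (n + k + 1) : ℤ)

theorem catalanTriangle_eq_zero {n k : ℕ} (h : n < k) : catalanTriangle n k = 0 := by
  unfold catalanTriangle
  rw [Nat.choose_eq_zero_of_lt (by omega), Nat.choose_eq_zero_of_lt (by omega), sub_self]

theorem catalanTriangle_self (n : ℕ) : catalanTriangle n n = 1 := by
  unfold catalanTriangle
  rw [← two_mul, Nat.choose_self, Nat.choose_succ_self]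
  simp

theorem catalanTriangle_zero_right (n : ℕ) : catalanTriangle n 0 = (catalan n : ℤ) := by
  have h₁ : ((n : ℤ) + 1) * catalan n = (2 * n).choose n := by
    exact_mod_cast succ_mul_catalan_eq_centralBinom n
  have h₂ := Nat.choose_succ_right_eq (2 * n) n
  rw [show 2 * n - n = n by omega] at h₂
  have h₃ : ((2 * n).choose (n + 1) : ℤ) * (n + 1) = (2 * n).choose n * n := by
    exact_mod_cast h₂
  have h₄ : ((n : ℤ) + 1) ≠ 0 := by positivity
  apply mul_left_cancel₀ h₄
  unfold catalanTriangle
  rw [add_zero]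
  linear_combination -h₃ - h₁

theorem catalanTriangle_succ_zero (n : ℕ) :
    catalanTriangle (n + 1) 0 = catalanTriangle n 0 + catalanTriangle n 1 := by
  have h := Nat.choose_symm_half n
  have h₁ := Nat.choose_succ_succ' (2 * n + 1) n
  have h₂ := Nat.choose_succ_succ' (2 * n + 1) (n + 1)
  have h₃ := Nat.choose_succ_succ' (2 * n) n
  have h₄ := Nat.choose_succ_succ' (2 * n) (n + 1)
  simp only [catalanTriangle, mul_add, mul_one, add_zero, add_assoc, Nat.reduceAdd] at *
  omega

theorem catalanTriangle_succ_succ (n k : ℕ) :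
    catalanTriangle (n + 1) (k + 1) =
      catalanTriangle n k + 2 * catalanTriangle n (k + 1) + catalanTriangle n (k + 2) := by
  have h (r : ℕ) : (2 * (n + 1)).choose (r + 2) =
      (2 * n).choose r + 2 * (2 * n).choose (r + 1) + (2 * n).choose (r + 2) := by
    rw [mul_add, mul_one, Nat.choose_succ_succ', Nat.choose_succ_succ', Nat.choose_succ_succ']
    ring
  simp only [catalanTriangle]
  rw [show n + 1 + (k + 1) = n + k + 2 by ring, show n + k + 2 + 1 = n + k + 1 + 2 by ring, h, h]
  simp only [← add_assoc]
  push_cast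
  ring

theorem sum_catalanTriangle_succ_mul_sub (m n N : ℕ) :
    ∑ k ∈ Finset.range (N + 1), (catalanTriangle (m + 1) k * catalanTriangle n k -
        catalanTriangle m k * catalanTriangle (n + 1) k) =
      catalanTriangle m (N + 1) * catalanTriangle n N -
        catalanTriangle m N * catalanTriangle n (N + 1) := by
  induction N with
  | zero =>
    simp only [zero_add, Finset.sum_range_one, catalanTriangle_succ_zero]
    ring
  | succ N ih =>
    rw [Finset.sum_range_succ, ih, catalanTriangle_succ_succ, catalanTriangle_succ_succ]
    ring

theorem sum_catalanTriangle_mul {m N : ℕ} (h : m ≤ N) (n : ℕ) :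
    ∑ k ∈ Finset.range (N + 1), catalanTriangle m k * catalanTriangle n k =
      (catalan (m + n) : ℤ) := by
  induction m generalizing n with
  | zero =>
    rw [Finset.sum_range_succ', Finset.sum_eq_zero, catalanTriangle_self,
      catalanTriangle_zero_right]
    · simp
    · intro k _
      rw [catalanTriangle_eq_zero k.succ_pos, zero_mul]
  | succ m ih =>
    have hs := sum_catalanTriangle_succ_mul_sub m n N
    rw [catalanTriangle_eq_zero (show m < N + 1 by omega),
      catalanTriangle_eq_zero (show m < N by omega), Finset.sum_sub_distrib,
      ih (by omega) (n + 1)] at hs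
    rw [show m + 1 + n = m + (n + 1) by ring]
    linarith

/-- The entries of the tridiagonal matrix with unit off-diagonal entries, first diagonal entry `a` and remaining
diagonal entries `3`. -/
def tridiagEntry (a : ℤ) (l k : ℕ) : ℤ :=
  (if l = k then (if k = 0 then a else 3) else 0) + (if l = k + 1 then 1 else 0) +
    (if l + 1 = k then 1 else 0)

theorem tridiagEntry_succ_succ (a : ℤ) (l k : ℕ) :
    tridiagEntry a (l + 1) (k + 1) = tridiagEntry 3 l k := by
  simp [tridiagEntry]

theorem sum_catalanTriangle_mul_tridiagEntry {i N : ℕ} (hi : i ≤ N) {k : ℕ} (hk : k ≤ N) :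
    ∑ l ∈ Finset.range (N + 1), catalanTriangle i l * tridiagEntry 2 l k =
      catalanTriangle i k + catalanTriangle (i + 1) k := by
  have hz : N < k + 1 → catalanTriangle i (k + 1) = 0 := fun h =>
    catalanTriangle_eq_zero (by omega)
  cases k with
  | zero =>
    simp only [tridiagEntry, mul_add, Finset.sum_add_distrib, catalanTriangle_succ_zero]
    simp
    grind
  | succ k =>
    simp only [tridiagEntry, mul_add, Finset.sum_add_distrib, catalanTriangle_succ_succ]
    simp
    grind

theorem det_tridiagEntry (a : ℤ) (n : ℕ) :
    (Matrix.of fun i j : Fin (n + 2) => tridiagEntry a i j).det =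
      a * (Matrix.of fun i j : Fin (n + 1) => tridiagEntry 3 i j).det -
        (Matrix.of fun i j : Fin n => tridiagEntry 3 i j).det := by
  rw [Matrix.det_succ_row_zero, Fin.sum_univ_succ, Fin.sum_univ_succ, Finset.sum_eq_zero]
  · have h₀ : (Matrix.of fun i j : Fin (n + 2) => tridiagEntry a i j).submatrix Fin.succ
        (Fin.succAbove 0) = Matrix.of fun i j : Fin (n + 1) => tridiagEntry 3 i j := by
      ext i j
      simp [tridiagEntry_succ_succ]
    have h₁ : ((Matrix.of fun i j : Fin (n + 2) => tridiagEntry a i j).submatrix Fin.succ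
        (Fin.succAbove (Fin.succ 0))).det =
          (Matrix.of fun i j : Fin n => tridiagEntry 3 i j).det := by
      rw [Matrix.det_succ_column_zero, Fin.sum_univ_succ, Finset.sum_eq_zero]
      · have h : ((Matrix.of fun i j : Fin (n + 2) => tridiagEntry a i j).submatrix Fin.succ
            (Fin.succAbove (Fin.succ 0))).submatrix (Fin.succAbove 0) Fin.succ =
              Matrix.of fun i j : Fin n => tridiagEntry 3 i j := by
          ext i j
          simp [tridiagEntry_succ_succ]
        rw [h]
        simp [tridiagEntry]
      · intro i _
        simp [tridiagEntry]
    rw [h₀, h₁]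
    simp [tridiagEntry]
    ring
  · intro j _
    simp [tridiagEntry]

theorem det_tridiagEntry_three (n : ℕ) :
    (Matrix.of fun i j : Fin n => tridiagEntry 3 i j).det = (Nat.fib (2 * n + 2) : ℤ) := by
  induction n using Nat.twoStepInduction with
  | zero => simp
  | one => simp [tridiagEntry]; rfl
  | more n ih₀ ih₁ =>
    rw [det_tridiagEntry, ih₀, ih₁]
    have h₁ := Nat.fib_add_two (n := 2 * n + 2)
    have h₂ := Nat.fib_add_two (n := 2 * n + 3)
    have h₃ := Nat.fib_add_two (n := 2 * n + 4)
    simp only [mul_add, mul_one, add_assoc, Nat.reduceAdd, Nat.reduceMul] at *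
    omega

theorem det_tridiagEntry_two (n : ℕ) :
    (Matrix.of fun i j : Fin (n + 1) => tridiagEntry 2 i j).det = (Nat.fib (2 * n + 3) : ℤ) := by
  cases n with
  | zero => simp [tridiagEntry]; rfl
  | succ n =>
    rw [det_tridiagEntry, det_tridiagEntry_three, det_tridiagEntry_three]
    have h₁ := Nat.fib_add_two (n := 2 * n + 2)
    have h₂ := Nat.fib_add_two (n := 2 * n + 3)
    simp only [mul_add, mul_one, add_assoc, Nat.reduceAdd] at *
    omega

/-- The Hankel transform of the sums of consecutive Catalan numbers `C(n)+C(n+1)` is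
given by the odd-indexed Fibonacci numbers `F(2n+3)`. -/
theorem hankel_sum_consecutive_catalan (n : ℕ) :
    Matrix.det (Matrix.of fun i j : Fin (n + 1) =>
        ((catalan ((i : ℕ) + (j : ℕ)) : ℤ) + (catalan ((i : ℕ) + (j : ℕ) + 1) : ℤ)))
      = (Nat.fib (2 * n + 3) : ℤ) := by
  set L : Matrix (Fin (n + 1)) (Fin (n + 1)) ℤ := Matrix.of fun i k => catalanTriangle i k with hL
  set T : Matrix (Fin (n + 1)) (Fin (n + 1)) ℤ := Matrix.of fun l k => tridiagEntry 2 l k with hT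
  have hdet : L.det = 1 := by
    rw [Matrix.det_of_isLowerTriangular]
    · simp [hL, catalanTriangle_self]
    · intro i j hij
      exact catalanTriangle_eq_zero hij
  have hfac : (Matrix.of fun i j : Fin (n + 1) =>
      ((catalan ((i : ℕ) + (j : ℕ)) : ℤ) + (catalan ((i : ℕ) + (j : ℕ) + 1) : ℤ))) =
      L * T * L.transpose := by
    ext i j
    have hi : (i : ℕ) ≤ n := by omega
    have hj : (j : ℕ) ≤ n := by omega
    have hLT (k : Fin (n + 1)) :
        (L * T) i k = catalanTriangle i k + catalanTriangle (i + 1) k := by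
      rw [Matrix.mul_apply, ← sum_catalanTriangle_mul_tridiagEntry hi (show (k : ℕ) ≤ n by omega),
        Finset.sum_range]
      rfl
    rw [Matrix.mul_apply]
    simp only [hLT]
    simp only [Matrix.transpose_apply, hL, Matrix.of_apply, add_mul, Finset.sum_add_distrib]
    have h₁ := sum_catalanTriangle_mul hi j
    have h₂ := sum_catalanTriangle_mul hj (i + 1)
    rw [Finset.sum_range] at h₁ h₂
    rw [h₁, show (i : ℕ) + j + 1 = j + (i + 1) by ring, ← h₂]
    simp only [mul_comm]
  rw [hfac, Matrix.det_mul, Matrix.det_mul, Matrix.det_transpose, hdet, hT, det_tridiagEntry_two]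
  ring
end
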